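/- arXiv:0812.4962 — 3 statements merged into one kernel-verified Lean document; each statement's English description precedes it below -/
import Mathlib

section
/- Let n ≥ 1 be an integer and let S ⊆ {1,…,n} with complement S^c = {1,…,n} \ S. Then n^{|S|} · Π_{(s,t) ∈ S^c×S^c, s ≠ t} |2 sin((s−t)π/n)| = n^{n−|S|} · Π_{(s,t) ∈ S×S, s ≠ t} |2 sin((s−t)π/n)|, where both products are over ordered pairs of distinct elements. -/
open Finset Real

/-- The powers `ζ, …, ζ ^ n` of a primitive `n`-th root of unity are the roots of `X ^ n - 1`. -/
theorem IsPrimitiveRoot.nodal_Icc_eq {R : Type*} [CommRing R] [IsDomain R] {ζ : R} {n : ℕ}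
    (h : IsPrimitiveRoot ζ n) (hn : 0 < n) :
    Lagrange.nodal (Icc 1 n) (fun t => ζ ^ t) = Polynomial.X ^ n - 1 := by
  classical
  have hinj : Set.InjOn (fun t => ζ ^ t) (Icc 1 n : Finset ℕ) := by
    intro a ha b hb hab
    simp only [coe_Icc, Set.mem_Icc] at ha hb
    have hab' : ζ ^ (a - 1) = ζ ^ (b - 1) := by
      refine mul_right_cancel₀ (h.ne_zero hn.ne') ?_
      rwa [← pow_succ, ← pow_succ, Nat.sub_add_cancel ha.1, Nat.sub_add_cancel hb.1]
    have := h.pow_inj (by omega) (by omega) hab'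
    omega
  have himage : (Icc 1 n).image (fun t => ζ ^ t) = Polynomial.nthRootsFinset n (1 : R) := by
    refine eq_of_subset_of_card_le (fun x hx => ?_) ?_
    · obtain ⟨t, -, rfl⟩ := mem_image.mp hx
      rw [Polynomial.mem_nthRootsFinset hn, pow_right_comm, h.pow_eq_one, one_pow]
    · rw [h.card_nthRootsFinset, card_image_of_injOn hinj, Nat.card_Icc, Nat.add_sub_cancel]
  rw [Polynomial.X_pow_sub_one_eq_prod hn h, ← himage, prod_image hinj, Lagrange.nodal]

/-- The chord between two `n`-th roots of unity. -/
theorem Complex.norm_exp_pow_sub_exp_pow (n s t : ℕ) :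
    ‖Complex.exp (2 * π * Complex.I / n) ^ s - Complex.exp (2 * π * Complex.I / n) ^ t‖ =
      |2 * Real.sin (((s : ℝ) - t) * π / n)| := by
  have hs : Complex.exp (2 * π * Complex.I / n) ^ s =
      Complex.exp ((2 * π * t / n : ℝ) * Complex.I) *
        Complex.exp (Complex.I * (2 * (((s : ℝ) - t) * π / n) : ℝ)) := by
    rw [← Complex.exp_nat_mul, ← Complex.exp_add]
    congr 1
    push_cast
    ring
  have ht : Complex.exp (2 * π * Complex.I / n) ^ t =
      Complex.exp ((2 * π * t / n : ℝ) * Complex.I) := by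
    rw [← Complex.exp_nat_mul]
    congr 1
    push_cast
    ring
  rw [hs, ht, ← mul_sub_one, norm_mul, Complex.norm_exp_ofReal_mul_I, one_mul,
    Complex.norm_exp_I_mul_ofReal_sub_one, mul_div_cancel_left₀ _ two_ne_zero, Real.norm_eq_abs]

/-- The product of the chords from one vertex of the regular `n`-gon to all others is `n`. -/
theorem prod_erase_abs_two_mul_sin {n s : ℕ} (hs : s ∈ Icc 1 n) :
    ∏ t ∈ (Icc 1 n).erase s, |2 * Real.sin (((s : ℝ) - t) * π / n)| = n := by
  have hn : n ≠ 0 := by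
    rw [mem_Icc] at hs
    omega
  have hζ := Complex.isPrimitiveRoot_exp n hn
  have hd := Lagrange.eval_nodal_derivative_eval_node_eq
    (v := fun t : ℕ => Complex.exp (2 * π * Complex.I / n) ^ t) hs
  rw [hζ.nodal_Icc_eq (Nat.pos_of_ne_zero hn), Lagrange.eval_nodal] at hd
  have hnorm := congrArg norm hd
  simpa [Polynomial.derivative_X_pow, norm_prod, Complex.norm_exp_pow_sub_exp_pow,
    hζ.norm'_eq_one hn] using hnorm.symm

/-- If a symmetric kernel on `I` has all its off-diagonal row products equal to `c`, then its
off-diagonal products over `S × S` and over the square of the complement of `S` in `I` agree up to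
powers of `c`. -/
theorem Finset.pow_card_mul_prod_offDiag_sdiff {α M : Type*} [DecidableEq α] [CommMonoid M]
    {I S : Finset α} (hS : S ⊆ I) {f : α → α → M} (hf : ∀ s t, f s t = f t s) {c : M}
    (hrow : ∀ s ∈ I, ∏ t ∈ I.erase s, f s t = c) :
    c ^ #S * ∏ p ∈ ((I \ S) ×ˢ (I \ S)).filter (fun p => p.1 ≠ p.2), f p.1 p.2 =
      c ^ #(I \ S) * ∏ p ∈ (S ×ˢ S).filter (fun p => p.1 ≠ p.2), f p.1 p.2 := by
  let g : α → α → M := fun s t => if s ≠ t then f s t else 1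
  have hg (s t : α) : g s t = g t s := by simp only [g, hf s t, ne_comm]
  have hsplit (s : α) (hs : s ∈ I) : (∏ t ∈ I \ S, g s t) * ∏ t ∈ S, g s t = c := by
    rw [prod_sdiff hS, ← hrow s hs, ← filter_ne, prod_filter]
  have hpow (A : Finset α) (hA : A ⊆ I) :
      c ^ #A = (∏ s ∈ A, ∏ t ∈ I \ S, g s t) * ∏ s ∈ A, ∏ t ∈ S, g s t := by
    rw [← prod_mul_distrib, prod_congr rfl fun s hs => hsplit s (hA hs), prod_const]
  have hcross : ∏ s ∈ I \ S, ∏ t ∈ S, g s t = ∏ s ∈ S, ∏ t ∈ I \ S, g s t := by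
    rw [prod_comm]
    simp only [hg]
  rw [prod_filter, prod_filter, prod_product, prod_product, hpow S hS, hpow _ sdiff_subset, hcross]
  simp only [g]
  ac_rfl

/-- Term-by-term identity underlying the level-rank symmetry of the Verlinde numbers:
replacing a subset `S ⊆ {1,…,n}` by its complement. -/
theorem sin_prod_compl (n : ℕ) (hn : 1 ≤ n) (S : Finset ℕ) (hS : S ⊆ Finset.Icc 1 n) :
    (n : ℝ) ^ S.card *
      ∏ p ∈ ((Finset.Icc 1 n \ S) ×ˢ (Finset.Icc 1 n \ S)).filter (fun p => p.1 ≠ p.2),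
        |2 * Real.sin (((p.1 : ℝ) - (p.2 : ℝ)) * Real.pi / n)| =
    (n : ℝ) ^ (n - S.card) *
      ∏ p ∈ (S ×ˢ S).filter (fun p => p.1 ≠ p.2),
        |2 * Real.sin (((p.1 : ℝ) - (p.2 : ℝ)) * Real.pi / n)| := by
  have h := pow_card_mul_prod_offDiag_sdiff hS
    (f := fun s t : ℕ => |2 * Real.sin (((s : ℝ) - (t : ℝ)) * Real.pi / n)|)
    (fun s t => by rw [← neg_sub, neg_mul, neg_div, Real.sin_neg, mul_neg, abs_neg])
    fun s hs => prod_erase_abs_two_mul_sin hs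
  rwa [card_sdiff_of_subset hS, Nat.card_Icc, Nat.add_sub_cancel] at h
end

section
/- Let g ≥ 1 be an integer, let r, k be positive integers, and let δ be a positive divisor of gcd(r,k). Then v_{δ(g−1)+1}(r/δ, k/δ) = (r+k)^{r(g−1)} · Σ_{S} Π_{(s,t) ∈ S×S, s ≠ t} |2 sin((s−t)π/(r+k))|^{1−g}, where the sum is over all subsets S ⊆ {1,…,r+k} with |S| = r which have δ as a coperiod, and the product is over ordered pairs of distinct elements of S. -/
open Finset Real
open scoped Classical

/-- The Verlinde number `v_g(r,k)`. -/
noncomputable def verlinde (g r k : ℕ) : ℝ :=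
  ((r : ℝ) + k) ^ (r * (g - 1)) *
    ∑ S ∈ (Finset.Icc 1 (r + k)).powersetCard r,
      ∏ p ∈ (S ×ˢ S).filter (fun p => p.1 ≠ p.2),
        |2 * Real.sin (((p.1 : ℝ) - (p.2 : ℝ)) * Real.pi / ((r : ℝ) + k))| ^ (1 - (g : ℤ))

/-- A positive integer `δ` is a coperiod of `S ⊆ {1,…,r+k}`, `|S| = r`, if `δ ∣ gcd(r,k)`
and `S = ⋃_{i=0}^{δ−1} (S̃ + i·(r+k)/δ)` for some `S̃ ⊆ {1,…,(r+k)/δ}` with `|S̃| = r/δ`. -/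
def IsCoperiod (r k δ : ℕ) (S : Finset ℕ) : Prop :=
  δ ∣ Nat.gcd r k ∧
    ∃ T ⊆ Finset.Icc 1 ((r + k) / δ), T.card = r / δ ∧
      S = (Finset.range δ).biUnion (fun i => T.image (fun s => s + i * ((r + k) / δ)))

/-- The distance between two points of the unit circle in terms of the sine of half the angle. -/
lemma norm_exp_I_mul_sub_exp_I_mul (x y : ℝ) :
    ‖Complex.exp (Complex.I * (2 * x : ℝ)) - Complex.exp (Complex.I * (2 * y : ℝ))‖ =
      |2 * sin (x - y)| := by
  have h : Complex.exp (Complex.I * (2 * x : ℝ)) - Complex.exp (Complex.I * (2 * y : ℝ)) =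
      Complex.exp (Complex.I * (2 * y : ℝ)) *
        (Complex.exp (Complex.I * (2 * (x - y) : ℝ)) - 1) := by
    rw [mul_sub, ← Complex.exp_add, mul_one]
    congr 2
    push_cast
    ring
  rw [h, norm_mul, Complex.norm_exp_I_mul_ofReal, one_mul, Complex.norm_exp_I_mul_ofReal_sub_one,
    Real.norm_eq_abs, mul_div_cancel_left₀ _ (two_ne_zero' ℝ)]

/-- The multiple-angle product formula for the sine, up to sign. -/
lemma prod_abs_two_mul_sin_sub {n : ℕ} (hn : 0 < n) (x : ℝ) :
    ∏ j ∈ range n, |2 * sin (x - j * π / n)| = |2 * sin (n * x)| := by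
  have hn' : (n : ℂ) ≠ 0 := by exact_mod_cast hn.ne'
  have h := congrArg (Polynomial.eval (Complex.exp (Complex.I * (2 * x : ℝ))))
    (X_pow_sub_C_eq_prod (Complex.isPrimitiveRoot_exp n hn.ne') hn (one_pow n))
  simp only [Polynomial.eval_sub, Polynomial.eval_pow, Polynomial.eval_X, Polynomial.eval_C,
    Polynomial.eval_prod, mul_one] at h
  have hpow : Complex.exp (Complex.I * (2 * x : ℝ)) ^ n - 1 =
      Complex.exp (Complex.I * (2 * (n * x) : ℝ)) - Complex.exp (Complex.I * (2 * 0 : ℝ)) := by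
    rw [← Complex.exp_nat_mul]
    push_cast
    simp only [mul_zero, Complex.exp_zero]
    congr 2
    ring
  rw [hpow] at h
  have h' := congrArg norm h
  rw [norm_exp_I_mul_sub_exp_I_mul, norm_prod, sub_zero] at h'
  rw [h']
  refine prod_congr rfl fun j _ => ?_
  rw [← norm_exp_I_mul_sub_exp_I_mul, ← Complex.exp_nat_mul]
  congr 3
  push_cast
  field_simp

lemma abs_sin_add_nat_mul_pi (x : ℝ) (n : ℕ) : |sin (x + n * π)| = |sin x| := by
  rw [sin_add_nat_mul_pi, abs_mul, abs_pow, abs_neg, abs_one, one_pow, one_mul]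

lemma prod_abs_two_mul_sin_add_sub {n : ℕ} (hn : 0 < n) (i : ℕ) (x : ℝ) :
    ∏ j ∈ range n, |2 * sin (x + i * π / n - j * π / n)| = |2 * sin (n * x)| := by
  have hn' : (n : ℝ) ≠ 0 := by exact_mod_cast hn.ne'
  rw [prod_abs_two_mul_sin_sub hn, mul_add, mul_div_cancel₀ _ hn', abs_mul, abs_mul,
    abs_sin_add_nat_mul_pi]

lemma sin_eq_mul_sinc (x : ℝ) : sin x = x * sinc x := by
  rcases eq_or_ne x 0 with rfl | hx
  · simp
  · rw [sinc_of_ne_zero hx, mul_div_cancel₀ _ hx]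

/-- The product of the distances from one `n`-th root of unity to all the others is `n`. -/
lemma prod_erase_abs_two_mul_sin_s5 {n i : ℕ} (hi : i < n) :
    ∏ j ∈ (range n).erase i, |2 * sin (i * π / n - j * π / n)| = n := by
  have hn : 0 < n := by omega
  have h : (fun x : ℝ => |sinc x| *
        ∏ j ∈ (range n).erase i, |2 * sin (x + i * π / n - j * π / n)|) =
      fun x : ℝ => n * |sinc (n * x)| := by
    refine Continuous.ext_on (dense_compl_singleton (0 : ℝ)) ?_ ?_ fun x hx => ?_
    · have := continuous_sinc
      fun_prop
    · have := continuous_sinc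
      fun_prop
    · have hx : x ≠ 0 := hx
      have hprod := prod_abs_two_mul_sin_add_sub hn i x
      rw [← mul_prod_erase _ _ (mem_range.2 hi), add_sub_cancel_right, sin_eq_mul_sinc x,
        sin_eq_mul_sinc (n * x)] at hprod
      simp only [abs_mul, Nat.abs_cast] at hprod ⊢
      have h2 : |(2 : ℝ)| * |x| ≠ 0 := by positivity
      refine mul_left_cancel₀ h2 ?_
      linear_combination hprod
  simpa using congrFun h 0

/-- The union of the `δ` translates of `T` by the multiples of `m`. -/
def translates (δ m : ℕ) (T : Finset ℕ) : Finset ℕ :=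
  (range δ).biUnion fun i => T.image fun s => s + i * m

lemma eq_and_eq_of_add_mul_eq {m s t i j : ℕ} (hs : s ∈ Icc 1 m) (ht : t ∈ Icc 1 m)
    (h : s + i * m = t + j * m) : s = t ∧ i = j := by
  rw [mem_Icc] at hs ht
  have hij : i = j := by
    rcases lt_trichotomy i j with hlt | heq | hlt
    · nlinarith
    · exact heq
    · nlinarith
  subst hij
  exact ⟨by omega, rfl⟩

lemma prod_translates {M : Type*} [CommMonoid M] {δ m : ℕ} {T : Finset ℕ} (hT : T ⊆ Icc 1 m)
    (f : ℕ → M) :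
    ∏ u ∈ translates δ m T, f u = ∏ s ∈ T, ∏ i ∈ range δ, f (s + i * m) := by
  rw [translates, prod_biUnion, prod_comm]
  · refine prod_congr rfl fun i _ => prod_image fun s _ t _ h => ?_
    exact Nat.add_right_cancel h
  · intro i _ j _ hij
    simp only [Function.onFun, disjoint_left, mem_image]
    rintro _ ⟨s, hs, rfl⟩ ⟨t, ht, h⟩
    exact hij (eq_and_eq_of_add_mul_eq (hT ht) (hT hs) h).2.symm

lemma card_translates {δ m : ℕ} {T : Finset ℕ} (hT : T ⊆ Icc 1 m) :
    (translates δ m T).card = δ * T.card := by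
  have h := prod_translates (δ := δ) hT fun _ => 2
  simp only [prod_const, card_range, ← pow_mul] at h
  exact Nat.pow_right_injective le_rfl h

lemma translates_subset {δ m : ℕ} {T : Finset ℕ} (hT : T ⊆ Icc 1 m) :
    translates δ m T ⊆ Icc 1 (δ * m) := by
  intro u hu
  simp only [translates, mem_biUnion, mem_image, mem_range] at hu
  obtain ⟨i, hi, s, hs, rfl⟩ := hu
  have := mem_Icc.1 (hT hs)
  rw [mem_Icc]
  constructor
  · omega
  · nlinarith

lemma translates_inter_Icc {δ m : ℕ} (hδ : 0 < δ) {T : Finset ℕ} (hT : T ⊆ Icc 1 m) :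
    translates δ m T ∩ Icc 1 m = T := by
  ext u
  simp only [translates, mem_inter, mem_biUnion, mem_image, mem_range]
  constructor
  · rintro ⟨⟨i, _, s, hs, h⟩, hu⟩
    have := (eq_and_eq_of_add_mul_eq (i := i) (j := 0) (hT hs) hu (by simpa using h)).1
    exact this ▸ hs
  · exact fun hu => ⟨⟨0, hδ, u, hu, by simp⟩, hT hu⟩

/-- The product of `|2 sin ((s - t) π / N)|` over ordered pairs of distinct elements of `S`. -/
noncomputable def sinProd (N : ℝ) (S : Finset ℕ) : ℝ :=
  ∏ p ∈ (S ×ˢ S).filter (fun p => p.1 ≠ p.2), |2 * sin (((p.1 : ℝ) - (p.2 : ℝ)) * π / N)|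

lemma sinProd_eq_prod_prod (N : ℝ) (S : Finset ℕ) :
    sinProd N S = ∏ s ∈ S, ∏ t ∈ S,
      if s ≠ t then |2 * sin (((s : ℝ) - (t : ℝ)) * π / N)| else 1 := by
  rw [sinProd, prod_filter, prod_product]

lemma sinProd_translates {δ m : ℕ} (hδ : 0 < δ) (hm : 0 < m) {T : Finset ℕ}
    (hT : T ⊆ Icc 1 m) :
    sinProd (δ * m) (translates δ m T) = (δ : ℝ) ^ (δ * T.card) * sinProd m T ^ δ := by
  have hδ' : (δ : ℝ) ≠ 0 := by exact_mod_cast hδ.ne'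
  have hm' : (m : ℝ) ≠ 0 := by exact_mod_cast hm.ne'
  have key : ∀ s ∈ T, ∀ i ∈ range δ, ∀ t ∈ T,
      (∏ j ∈ range δ, if s + i * m ≠ t + j * m then
        |2 * sin ((((s + i * m : ℕ) : ℝ) - ((t + j * m : ℕ) : ℝ)) * π / (δ * m))| else 1) =
      (if s = t then (δ : ℝ) else 1) *
        if s ≠ t then |2 * sin (((s : ℝ) - (t : ℝ)) * π / m)| else 1 := by
    intro s hs i hi t ht
    have hangle : ∀ j : ℕ, (((s + i * m : ℕ) : ℝ) - ((t + j * m : ℕ) : ℝ)) * π / (δ * m) =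
        ((s : ℝ) - t) * π / (δ * m) + i * π / δ - j * π / δ := by
      intro j
      push_cast
      field_simp
      ring
    simp only [hangle]
    rcases eq_or_ne s t with rfl | hst
    · simp only [sub_self, zero_mul, zero_div, zero_add, if_true, ne_eq, not_true, if_false,
        mul_one]
      refine Eq.trans ?_ (prod_erase_abs_two_mul_sin_s5 (mem_range.1 hi))
      rw [← mul_prod_erase _ _ hi, if_neg (not_not.2 rfl), one_mul]
      refine prod_congr rfl fun j hj => if_pos fun h => ?_
      exact (mem_erase.1 hj).1 (eq_and_eq_of_add_mul_eq (hT hs) (hT hs) h).2.symm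
    · rw [if_neg hst, if_pos hst, one_mul]
      have hmul : ((s : ℝ) - t) * π / m = δ * (((s : ℝ) - t) * π / (δ * m)) := by
        field_simp
      rw [hmul, ← prod_abs_two_mul_sin_add_sub hδ i]
      refine prod_congr rfl fun j _ => if_pos fun h => ?_
      exact hst (eq_and_eq_of_add_mul_eq (hT hs) (hT ht) h).1
  rw [sinProd_eq_prod_prod, sinProd_eq_prod_prod, prod_translates hT]
  calc _ = ∏ s ∈ T, ∏ i ∈ range δ, ∏ t ∈ T, ((if s = t then (δ : ℝ) else 1) *
        if s ≠ t then |2 * sin (((s : ℝ) - (t : ℝ)) * π / m)| else 1) := by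
        refine prod_congr rfl fun s hs => prod_congr rfl fun i hi => ?_
        rw [prod_translates hT]
        exact prod_congr rfl fun t ht => key s hs i hi t ht
    _ = ∏ s ∈ T, ((δ : ℝ) ^ δ * (∏ t ∈ T,
        if s ≠ t then |2 * sin (((s : ℝ) - (t : ℝ)) * π / m)| else 1) ^ δ) := by
        refine prod_congr rfl fun s hs => ?_
        rw [prod_const, card_range, prod_mul_distrib, prod_ite_eq, if_pos hs, mul_pow]
    _ = _ := by
        rw [prod_mul_distrib, prod_const, prod_pow, ← pow_mul]

lemma filter_isCoperiod_eq_image {δ : ℕ} (hδ : 0 < δ) (a b : ℕ) :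
    ((Icc 1 (δ * a + δ * b)).powersetCard (δ * a)).filter
        (fun S => IsCoperiod (δ * a) (δ * b) δ S) =
      ((Icc 1 (a + b)).powersetCard a).image (translates δ (a + b)) := by
  have hdiv : (δ * a + δ * b) / δ = a + b := by
    rw [← mul_add, Nat.mul_div_cancel_left _ hδ]
  ext S
  simp only [mem_filter, mem_powersetCard, mem_image, IsCoperiod, hdiv,
    Nat.mul_div_cancel_left _ hδ]
  constructor
  · rintro ⟨_, _, T, hT, hcard, rfl⟩
    exact ⟨T, ⟨hT, hcard⟩, rfl⟩
  · rintro ⟨T, ⟨hT, hcard⟩, rfl⟩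
    refine ⟨⟨?_, ?_⟩, ?_, T, hT, hcard, rfl⟩
    · rw [← mul_add]
      exact translates_subset hT
    · rw [card_translates hT, hcard]
    · exact Nat.dvd_gcd (dvd_mul_right _ _) (dvd_mul_right _ _)

/-- The Verlinde number `v_{δ(g−1)+1}(r/δ, k/δ)` equals the part of the sine sum
extended over `δ`-coperiodic subsets only. -/
theorem verlinde_coperiodic_sum (g r k δ : ℕ) (hg : 1 ≤ g) (hr : 0 < r) (hk : 0 < k)
    (hδ : 0 < δ) (hdvd : δ ∣ Nat.gcd r k) :
    verlinde (δ * (g - 1) + 1) (r / δ) (k / δ) =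
      ((r : ℝ) + k) ^ (r * (g - 1)) *
        ∑ S ∈ ((Finset.Icc 1 (r + k)).powersetCard r).filter (fun S => IsCoperiod r k δ S),
          ∏ p ∈ (S ×ˢ S).filter (fun p => p.1 ≠ p.2),
            |2 * Real.sin (((p.1 : ℝ) - (p.2 : ℝ)) * Real.pi / ((r : ℝ) + k))| ^ (1 - (g : ℤ)) := by
  obtain ⟨a, rfl⟩ := hdvd.trans (Nat.gcd_dvd_left r k)
  obtain ⟨b, rfl⟩ := hdvd.trans (Nat.gcd_dvd_right _ k)
  obtain ⟨e, rfl⟩ := Nat.exists_eq_add_of_le' hg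
  have hm : 0 < a + b := Nat.add_pos_left (Nat.pos_of_mul_pos_left hr) b
  have hδ' : (δ : ℝ) ≠ 0 := by exact_mod_cast hδ.ne'
  have hN : ((δ * a : ℕ) : ℝ) + ((δ * b : ℕ) : ℝ) = (δ : ℝ) * ((a + b : ℕ) : ℝ) := by
    push_cast
    ring
  have hexp : ∀ n : ℕ, (1 : ℤ) - ((n + 1 : ℕ) : ℤ) = -(n : ℤ) := fun n => by
    push_cast
    ring
  rw [filter_isCoperiod_eq_image hδ, sum_image fun T hT T' hT' h => by
    rw [← translates_inter_Icc hδ (mem_powersetCard.1 hT).1, h,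
      translates_inter_Icc hδ (mem_powersetCard.1 hT').1]]
  simp only [verlinde, Nat.mul_div_cancel_left _ hδ, hN, ← Nat.cast_add, hexp,
    Nat.add_sub_cancel, prod_zpow, mul_sum]
  refine sum_congr rfl fun T hT => ?_
  obtain ⟨hT, hcard⟩ := mem_powersetCard.1 hT
  change _ * sinProd _ T ^ _ = _ * sinProd _ (translates δ (a + b) T) ^ _
  rw [sinProd_translates hδ hm hT, hcard, zpow_neg, zpow_neg, zpow_natCast, zpow_natCast,
    mul_pow, mul_pow, ← pow_mul, ← pow_mul, mul_left_comm a δ e, ← mul_assoc δ a e]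
  field_simp
end

section
/- Let g ≥ 1 be an integer, h a positive integer, and δ a positive divisor of h. Then Σ_{ω | h} n_g(ω) · {(h/ω)/(h/δ)}_g equals h^{2g} if δ = h and equals 0 if δ < h, the sum being over all positive divisors ω of h. -/
open Finset

/-- The genus-`g` symbol `{λ/h}_g`. -/
noncomputable def genusSymbol (g lam h : ℕ) : ℝ :=
  if h = 1 then 1
  else if (∏ p ∈ h.primeFactors, p ^ (h.factorization p - 1)) ∣ lam then
    ∏ p ∈ h.primeFactors,
      ((if p ^ (h.factorization p) ∣ lam then (1 : ℝ) else 0) - (p : ℝ) ^ (-(2 * (g : ℤ))))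
  else 0

/-- `n_g(δ) = δ^{2g} · ∏_{p prime, p ∣ δ} (1 − p^{−2g})`. -/
noncomputable def jordanCount (g δ : ℕ) : ℝ :=
  (δ : ℝ) ^ (2 * g) * ∏ p ∈ δ.primeFactors, (1 - (p : ℝ) ^ (-(2 * (g : ℤ))))

/-- `jordanCount g` as an arithmetic function. -/
noncomputable def jordanArith (g : ℕ) (hg : 1 ≤ g) : ArithmeticFunction ℝ :=
  ⟨jordanCount g, by simp [jordanCount, Nat.one_le_iff_ne_zero.mp hg]⟩

theorem jordanArith_apply (g : ℕ) (hg : 1 ≤ g) (n : ℕ) :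
    jordanArith g hg n = jordanCount g n := rfl

theorem isMultiplicative_jordanArith (g : ℕ) (hg : 1 ≤ g) :
    (jordanArith g hg).IsMultiplicative := by
  refine ⟨by simp [jordanArith_apply, jordanCount], fun {m n} hmn => ?_⟩
  simp only [jordanArith_apply, jordanCount]
  rw [hmn.primeFactors_mul, prod_union hmn.disjoint_primeFactors]
  push_cast
  ring

/-- On a nontrivial prime power, the Jordan totient is a difference of consecutive powers. -/
theorem jordanCount_prime_pow_succ (g : ℕ) {p : ℕ} (hp : p.Prime) (k : ℕ) :
    jordanCount g (p ^ (k + 1)) =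
      ((p ^ (k + 1) : ℕ) : ℝ) ^ (2 * g) - ((p ^ k : ℕ) : ℝ) ^ (2 * g) := by
  have hp0 : (p : ℝ) ≠ 0 := by exact_mod_cast hp.ne_zero
  have hz : (p : ℝ) ^ (-(2 * (g : ℤ))) = ((p : ℝ) ^ (2 * g))⁻¹ := by
    rw [zpow_neg]
    norm_cast
  rw [jordanCount, Nat.primeFactors_prime_pow k.succ_ne_zero hp, prod_singleton, hz]
  push_cast
  have := pow_ne_zero (2 * g) hp0
  rw [pow_succ, mul_pow]
  field_simp

theorem sum_divisors_jordanCount (g : ℕ) (hg : 1 ≤ g) (n : ℕ) :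
    ∑ d ∈ n.divisors, jordanCount g d = (n : ℝ) ^ (2 * g) := by
  have hg0 : 2 * g ≠ 0 := by omega
  have key : jordanArith g hg * (ArithmeticFunction.zeta : ArithmeticFunction ℝ) =
      ((ArithmeticFunction.pow (2 * g) : ArithmeticFunction ℕ) : ArithmeticFunction ℝ) := by
    rw [ArithmeticFunction.IsMultiplicative.eq_iff_eq_on_prime_powers _
      ((isMultiplicative_jordanArith g hg).mul
        ArithmeticFunction.isMultiplicative_zeta.natCast) _
      ArithmeticFunction.isMultiplicative_pow.natCast]
    intro p k hp
    rw [ArithmeticFunction.coe_mul_zeta_apply, Nat.sum_divisors_prime_pow hp]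
    simp only [jordanArith_apply, ArithmeticFunction.natCoe_apply,
      ArithmeticFunction.pow_apply, hg0, false_and, if_false]
    induction k with
    | zero => simp [jordanCount]
    | succ k ih =>
      rw [sum_range_succ, ih, jordanCount_prime_pow_succ g hp]
      push_cast
      ring
  have h := DFunLike.congr_fun key n
  rw [ArithmeticFunction.coe_mul_zeta_apply] at h
  simpa [jordanArith_apply, ArithmeticFunction.pow_apply, hg0] using h

/-- A product of powers of distinct primes divides `n` iff each of the powers does. -/
theorem prod_prime_pow_dvd_iff {s : Finset ℕ} (hs : ∀ p ∈ s, p.Prime) (f : ℕ → ℕ) (n : ℕ) :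
    ∏ p ∈ s, p ^ f p ∣ n ↔ ∀ p ∈ s, p ^ f p ∣ n := by
  refine ⟨fun h p hp => (dvd_prod_of_mem _ hp).trans h, fun h => ?_⟩
  refine Finset.prod_dvd_of_isRelPrime (fun p hp q hq hpq => ?_) h
  exact Nat.coprime_iff_isRelPrime.mp
    (Nat.Coprime.pow _ _ ((Nat.coprime_primes (hs p hp) (hs q hq)).mpr hpq))

theorem genusSymbol_eq_prod (g n m : ℕ) :
    genusSymbol g n m = ∏ p ∈ m.primeFactors,
      ((if p ^ m.factorization p ∣ n then (1 : ℝ) else 0) -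
        (p : ℝ) ^ (-(2 * (g : ℤ))) * if p ^ (m.factorization p - 1) ∣ n then 1 else 0) := by
  have hprime : ∀ p ∈ m.primeFactors, p.Prime := fun p => Nat.prime_of_mem_primeFactors
  rw [genusSymbol]
  split_ifs with hm hdvd
  · simp [hm]
  · rw [prod_prime_pow_dvd_iff hprime] at hdvd
    exact prod_congr rfl fun p hp => by simp [hdvd p hp]
  · rw [prod_prime_pow_dvd_iff hprime] at hdvd
    push Not at hdvd
    obtain ⟨p, hp, hpn⟩ := hdvd
    refine (prod_eq_zero hp ?_).symm
    have : ¬ p ^ m.factorization p ∣ n := fun h => hpn ((pow_dvd_pow _ (Nat.sub_le _ _)).trans h)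
    simp [hpn, this]

/-- Lowering by one the exponents of the primes in `t` divides `m` by `∏ p ∈ t, p`. -/
theorem prod_primeFactors_pow_ite_mul_prod {m : ℕ} (hm : m ≠ 0) {t : Finset ℕ}
    (ht : t ⊆ m.primeFactors) :
    (∏ p ∈ m.primeFactors, p ^ (if p ∈ t then m.factorization p - 1 else m.factorization p)) *
      ∏ p ∈ t, p = m := by
  have htp : ∏ p ∈ t, p = ∏ p ∈ m.primeFactors, if p ∈ t then p else 1 := by
    rw [prod_ite_mem, inter_eq_right.mpr ht]
  rw [htp, ← prod_mul_distrib]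
  conv_rhs => rw [← Nat.prod_factorization_pow_eq_self hm]
  refine prod_congr rfl fun p hp => ?_
  split_ifs
  · have hpos := (Nat.prime_of_mem_primeFactors hp).factorization_pos_of_dvd hm
      (Nat.dvd_of_mem_primeFactors hp)
    rw [← pow_succ, Nat.sub_add_cancel hpos]
  · rw [mul_one]

/-- Möbius-type expansion of the genus symbol over sets of primes dividing `m`. -/
theorem genusSymbol_eq_sum_powerset (g n m : ℕ) (hm : m ≠ 0) :
    genusSymbol g n m = ∑ t ∈ m.primeFactors.powerset,
      (-1 : ℝ) ^ #t * ((∏ p ∈ t, p : ℕ) : ℝ) ^ (-(2 * (g : ℤ))) *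
        if m / ∏ p ∈ t, p ∣ n then 1 else 0 := by
  rw [genusSymbol_eq_prod, prod_sub]
  refine sum_congr rfl fun t ht => ?_
  rw [mem_powerset] at ht
  have hpos : 0 < ∏ p ∈ t, p :=
    prod_pos fun p hp => (Nat.prime_of_mem_primeFactors (ht hp)).pos
  have hdiv : m / ∏ p ∈ t, p = ∏ p ∈ m.primeFactors,
      p ^ (if p ∈ t then m.factorization p - 1 else m.factorization p) :=
    Nat.div_eq_of_eq_mul_left hpos (prod_primeFactors_pow_ite_mul_prod hm ht).symm
  have hind : (if m / ∏ p ∈ t, p ∣ n then (1 : ℝ) else 0) =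
      (∏ p ∈ m.primeFactors \ t, if p ^ m.factorization p ∣ n then (1 : ℝ) else 0) *
        ∏ p ∈ t, if p ^ (m.factorization p - 1) ∣ n then (1 : ℝ) else 0 := by
    simp only [hdiv, prod_prime_pow_dvd_iff fun p => Nat.prime_of_mem_primeFactors]
    rw [← prod_boole, ← prod_sdiff ht]
    congr 1
    · exact prod_congr rfl fun p hp => by simp [(mem_sdiff.mp hp).2]
    · exact prod_congr rfl fun p hp => by simp [hp]
  rw [hind, prod_mul_distrib, prod_zpow]
  push_cast
  ring

theorem sum_jordanCount_ite_dvd (g : ℕ) (hg : 1 ≤ g) {q d : ℕ} (hq : q ≠ 0) (hd : d ≠ 0) :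
    ∑ ω ∈ (d * q).divisors, jordanCount g ω * (if q ∣ d * q / ω then 1 else 0) =
      (d : ℝ) ^ (2 * g) := by
  rw [← sum_divisors_jordanCount g hg,
    ← Nat.divisors_filter_dvd_of_dvd (mul_ne_zero hd hq) (dvd_mul_right d q), sum_filter]
  refine sum_congr rfl fun ω hω => ?_
  have hiff : q ∣ d * q / ω ↔ ω ∣ d := by
    rw [Nat.dvd_div_iff_mul_dvd (Nat.dvd_of_mem_divisors hω)]
    exact Nat.mul_dvd_mul_iff_right (Nat.pos_of_ne_zero hq)
  simp [hiff]

theorem sum_jordanCount_mul_genusSymbol (g : ℕ) (hg : 1 ≤ g) {m δ : ℕ} (hm : m ≠ 0)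
    (hδ : δ ≠ 0) :
    ∑ ω ∈ (δ * m).divisors, jordanCount g ω * genusSymbol g (δ * m / ω) m =
      (δ : ℝ) ^ (2 * g) * ∑ t ∈ m.primeFactors.powerset, (-1 : ℝ) ^ #t := by
  simp only [genusSymbol_eq_sum_powerset g _ m hm, mul_sum]
  rw [sum_comm]
  refine sum_congr rfl fun t ht => ?_
  rw [mem_powerset] at ht
  set e := ∏ p ∈ t, p
  have he0 : e ≠ 0 :=
    prod_ne_zero_iff.mpr fun p hp => (Nat.prime_of_mem_primeFactors (ht hp)).ne_zero
  have hem : e * (m / e) = m :=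
    Nat.mul_div_cancel' ⟨_, ((mul_comm _ _).trans (prod_primeFactors_pow_ite_mul_prod hm ht)).symm⟩
  have hq : m / e ≠ 0 := fun h => hm (by rw [← hem, h, mul_zero])
  have hsum := sum_jordanCount_ite_dvd g hg hq (mul_ne_zero hδ he0)
  rw [mul_assoc, hem] at hsum
  have heR : (e : ℝ) ^ (2 * g) ≠ 0 := pow_ne_zero _ (by exact_mod_cast he0)
  have hz : (e : ℝ) ^ (-(2 * (g : ℤ))) = ((e : ℝ) ^ (2 * g))⁻¹ := by
    rw [zpow_neg]
    norm_cast
  simp only [mul_left_comm (jordanCount g _)]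
  rw [← mul_sum, hsum, hz]
  push_cast
  rw [mul_pow]
  field_simp

/-- For a positive divisor `δ` of `h`, the sum `∑_{ω ∣ h} n_g(ω) · {(h/ω)/(h/δ)}_g`
equals `h^{2g}` if `δ = h` and `0` if `δ < h`. -/
theorem sum_jordan_genusSymbol (g h δ : ℕ) (hg : 1 ≤ g) (hh : 0 < h)
    (hδ : 0 < δ) (hdvd : δ ∣ h) :
    (δ = h → ∑ ω ∈ h.divisors, jordanCount g ω * genusSymbol g (h / ω) (h / δ) =
        (h : ℝ) ^ (2 * g)) ∧
    (δ < h → ∑ ω ∈ h.divisors, jordanCount g ω * genusSymbol g (h / ω) (h / δ) = 0) := by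
  obtain ⟨m, rfl⟩ := hdvd
  have hm : m ≠ 0 := by
    rintro rfl
    simp at hh
  rw [Nat.mul_div_cancel_left m hδ, sum_jordanCount_mul_genusSymbol g hg hm hδ.ne']
  have hcast : ∑ t ∈ m.primeFactors.powerset, (-1 : ℝ) ^ #t =
      ((∑ t ∈ m.primeFactors.powerset, (-1 : ℤ) ^ #t : ℤ) : ℝ) := by
    push_cast
    rfl
  rw [hcast, sum_powerset_neg_one_pow_card]
  constructor
  · intro h
    have hm1 : m = 1 := by simpa [hδ.ne'] using h.symm
    simp [hm1]
  · intro h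
    have hm1 : m ≠ 1 := by
      rintro rfl
      simp at h
    simp [Nat.primeFactors_eq_empty, hm, hm1]
end
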